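/- arXiv:1707.02331 — 3 statements merged into one kernel-verified Lean document; each statement's English description precedes it below -/
import Mathlib

section
/- If K = diag(k₁,…,k_p) with each kᵢ > 0 and k₍₁₎ = min₁≤i≤p kᵢ, then the squared Euclidean norm of the GRR estimator satisfies (β̂ᴳ)ᵀβ̂ᴳ ≤ k₍₁₎⁻¹ YᵀY. -/
open Matrix

/-- The generalized ridge Gram matrix `XᵀX + diag(k)` is positive definite when `k > 0`. -/
theorem posDef_transpose_mul_self_add_diagonal {m n : Type*} [Fintype m] [Fintype n]
    [DecidableEq n] (X : Matrix m n ℝ) {k : n → ℝ} (hk : ∀ i, 0 < k i) :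
    (Xᵀ * X + Matrix.diagonal k).PosDef := by
  have hX : (Xᵀ * X).PosSemidef := by
    simpa using Matrix.posSemidef_conjTranspose_mul_self X
  exact Matrix.PosDef.posSemidef_add hX (Matrix.PosDef.diagonal hk)

/-- The normal equations tested against their own solution. -/
theorem dotProduct_add_dotProduct_diagonal_of_mulVec_eq {m n : Type*} [Fintype m] [Fintype n]
    [DecidableEq n] {X : Matrix m n ℝ} {k b : n → ℝ} {Y : m → ℝ}
    (h : (Xᵀ * X + Matrix.diagonal k) *ᵥ b = Xᵀ *ᵥ Y) :
    (X *ᵥ b) ⬝ᵥ (X *ᵥ b) + b ⬝ᵥ (Matrix.diagonal k *ᵥ b) = (X *ᵥ b) ⬝ᵥ Y := by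
  have hb := congrArg (b ⬝ᵥ ·) h
  simpa only [Matrix.add_mulVec, dotProduct_add, ← Matrix.mulVec_mulVec,
    Matrix.dotProduct_mulVec b Xᵀ, Matrix.vecMul_transpose] using hb

/-- If `K = diag(k₁,…,k_p)` with each `kᵢ > 0` and `k₍₁₎ = min kᵢ`, then the squared
Euclidean norm of the GRR estimator satisfies `(β̂ᴳ)ᵀ β̂ᴳ ≤ k₍₁₎⁻¹ YᵀY`. -/
theorem grr_norm_bound (n p : ℕ) (hn : 0 < n) (hp : 0 < p)
    (X : Matrix (Fin n) (Fin p) ℝ) (Y : Fin n → ℝ)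
    (k : Fin p → ℝ) (hk : ∀ i, 0 < k i)
    (k1 : ℝ) (hk1le : ∀ i, k1 ≤ k i) (hk1mem : ∃ i, k1 = k i)
    (βG : Fin p → ℝ)
    (hβG : βG = ((Xᵀ * X + Matrix.diagonal k)⁻¹ * Xᵀ).mulVec Y) :
    βG ⬝ᵥ βG ≤ k1⁻¹ * (Y ⬝ᵥ Y) := by
  have hk1 : 0 < k1 := by
    obtain ⟨i, rfl⟩ := hk1mem
    exact hk i
  have hdet : IsUnit (Xᵀ * X + Matrix.diagonal k).det :=
    (posDef_transpose_mul_self_add_diagonal X hk).det_pos.ne'.isUnit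
  have hnormal : (Xᵀ * X + Matrix.diagonal k) *ᵥ βG = Xᵀ *ᵥ Y := by
    rw [hβG, Matrix.mulVec_mulVec, Matrix.mul_nonsing_inv_cancel_left _ _ hdet]
  have henergy := dotProduct_add_dotProduct_diagonal_of_mulVec_eq hnormal
  have hpenalty : k1 * (βG ⬝ᵥ βG) ≤ βG ⬝ᵥ (Matrix.diagonal k *ᵥ βG) := by
    simp only [dotProduct, Matrix.mulVec_diagonal, Finset.mul_sum]
    refine Finset.sum_le_sum fun i _ => ?_
    nlinarith [mul_le_mul_of_nonneg_right (hk1le i) (mul_self_nonneg (βG i))]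
  have hfit : 0 ≤ (X *ᵥ βG) ⬝ᵥ (X *ᵥ βG) :=
    Finset.sum_nonneg fun i _ => mul_self_nonneg _
  have hY : 0 ≤ Y ⬝ᵥ Y := Finset.sum_nonneg fun i _ => mul_self_nonneg _
  have hresidual : 0 ≤ (Y - X *ᵥ βG) ⬝ᵥ (Y - X *ᵥ βG) :=
    Finset.sum_nonneg fun i _ => mul_self_nonneg _
  rw [sub_dotProduct, dotProduct_sub, dotProduct_sub, dotProduct_comm Y (X *ᵥ βG)] at hresidual
  rw [le_inv_mul_iff₀ hk1]
  linarith
end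

section
/- If K = diag(k₁,…,k_p) with each kᵢ > 0, k₍₁₎ = min₁≤i≤p kᵢ, and Y is a measurable random vector on a probability space (Ω, 𝓐, P) such that YᵀY is integrable, then (β̂ᴳ)ᵀβ̂ᴳ (with β̂ᴳ = S_K⁻¹XᵀY a random vector) is integrable and E[(β̂ᴳ)ᵀβ̂ᴳ] ≤ k₍₁₎⁻¹ E[YᵀY]. -/
open Matrix MeasureTheory

/-- If `K` is positive definite with `c ‖b‖² ≤ bᵀ K b` for all `b`, then the generalized ridge
estimator `b = (Xᵀ X + K)⁻¹ Xᵀ y` satisfies `c ‖b‖² ≤ ‖y‖²`. -/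
theorem mul_dotProduct_ridge_le {m n : Type*} [Fintype m] [Fintype n] [DecidableEq n]
    (X : Matrix m n ℝ) {K : Matrix n n ℝ} (hK : K.PosDef) {c : ℝ}
    (hc : ∀ b : n → ℝ, c * (b ⬝ᵥ b) ≤ b ⬝ᵥ K *ᵥ b) (y : m → ℝ) :
    c * ((((Xᵀ * X + K)⁻¹ * Xᵀ) *ᵥ y) ⬝ᵥ (((Xᵀ * X + K)⁻¹ * Xᵀ) *ᵥ y)) ≤ y ⬝ᵥ y := by
  have hS : (Xᵀ * X).PosSemidef := by
    simpa using posSemidef_conjTranspose_mul_self X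
  have hunit : IsUnit (Xᵀ * X + K).det :=
    (isUnit_iff_isUnit_det _).1 (PosDef.posSemidef_add hS hK).isUnit
  set b := ((Xᵀ * X + K)⁻¹ * Xᵀ) *ᵥ y with hb
  have normal_eq : (Xᵀ * X + K) *ᵥ b = Xᵀ *ᵥ y := by
    rw [hb, mulVec_mulVec, ← Matrix.mul_assoc, mul_nonsing_inv _ hunit, Matrix.one_mul]
  have key : (X *ᵥ b) ⬝ᵥ (X *ᵥ b) + b ⬝ᵥ K *ᵥ b = (X *ᵥ b) ⬝ᵥ y := by
    have h := congrArg (b ⬝ᵥ ·) normal_eq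
    simpa only [add_mulVec, dotProduct_add, ← mulVec_mulVec, dotProduct_mulVec b Xᵀ,
      vecMul_transpose] using h
  have hsq : 0 ≤ (y - X *ᵥ b) ⬝ᵥ (y - X *ᵥ b) := by
    simpa using dotProduct_star_self_nonneg (y - X *ᵥ b)
  have hXb : 0 ≤ (X *ᵥ b) ⬝ᵥ (X *ᵥ b) := by
    simpa using dotProduct_star_self_nonneg (X *ᵥ b)
  have hy : 0 ≤ y ⬝ᵥ y := by
    simpa using dotProduct_star_self_nonneg y
  simp only [sub_dotProduct, dotProduct_sub, dotProduct_comm y] at hsq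
  linarith [hc b]

/-- If `K = diag(k₁,…,k_p)` with each `kᵢ > 0`, `k₍₁₎ = min kᵢ`, and `Y` is a measurable
random vector with `YᵀY` integrable, then `(β̂ᴳ)ᵀ β̂ᴳ` is integrable and
`E[(β̂ᴳ)ᵀ β̂ᴳ] ≤ k₍₁₎⁻¹ E[YᵀY]`. -/
theorem grr_expected_norm_bound (n p : ℕ) (hn : 0 < n) (hp : 0 < p)
    (X : Matrix (Fin n) (Fin p) ℝ)
    (k : Fin p → ℝ) (hk : ∀ i, 0 < k i)
    (k1 : ℝ) (hk1le : ∀ i, k1 ≤ k i) (hk1mem : ∃ i, k1 = k i)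
    (Ω : Type*) [MeasurableSpace Ω] (μ : Measure Ω) [IsProbabilityMeasure μ]
    (Y : Ω → Fin n → ℝ) (hYm : Measurable Y)
    (hYint : Integrable (fun ω => Y ω ⬝ᵥ Y ω) μ)
    (βG : Ω → Fin p → ℝ)
    (hβG : ∀ ω, βG ω = ((Xᵀ * X + Matrix.diagonal k)⁻¹ * Xᵀ).mulVec (Y ω)) :
    Integrable (fun ω => βG ω ⬝ᵥ βG ω) μ ∧
      ∫ ω, βG ω ⬝ᵥ βG ω ∂μ ≤ k1⁻¹ * ∫ ω, Y ω ⬝ᵥ Y ω ∂μ := by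
  obtain ⟨i₀, hi₀⟩ := hk1mem
  have hk1 : 0 < k1 := hi₀ ▸ hk i₀
  have bound (ω : Ω) : βG ω ⬝ᵥ βG ω ≤ k1⁻¹ * (Y ω ⬝ᵥ Y ω) := by
    rw [le_inv_mul_iff₀ hk1, hβG]
    refine mul_dotProduct_ridge_le X (PosDef.diagonal hk) (fun b => ?_) (Y ω)
    simp only [dotProduct, mulVec_diagonal, Finset.mul_sum]
    refine Finset.sum_le_sum fun i _ => ?_
    linarith [mul_le_mul_of_nonneg_right (hk1le i) (mul_self_nonneg (b i))]
  have meas : Measurable fun ω => βG ω ⬝ᵥ βG ω := by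
    simp only [hβG, mulVec, dotProduct]
    fun_prop
  have int_bound := hYint.const_mul k1⁻¹
  have int_sq : Integrable (fun ω => βG ω ⬝ᵥ βG ω) μ := by
    refine int_bound.mono' meas.aestronglyMeasurable (ae_of_all _ fun ω => ?_)
    rw [Real.norm_of_nonneg (by simpa using dotProduct_star_self_nonneg (βG ω))]
    exact bound ω
  refine ⟨int_sq, ?_⟩
  rw [← integral_const_mul]
  exact integral_mono int_sq int_bound bound
end

section
/- (Theorem 1, bias of the linear shrinkage estimator) For ω ∈ [0,1], the linear shrinkage estimator β̂ᴸˢ = ω β̂ᴿ + (1−ω) β̂ᴳ has bias B(β̂ᴸˢ) = E[β̂ᴸˢ] − β = (S_K⁻¹S − I_p)β − ω(I_p − M_K)S_K⁻¹Sβ. -/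
open Matrix MeasureTheory

/-- The expectation commutes with a matrix acting on an integrable random vector. -/
theorem integral_mulVec_apply {Ω m n : Type*} [Fintype n] [MeasurableSpace Ω] {μ : Measure Ω}
    (A : Matrix m n ℝ) {Z : Ω → n → ℝ} (hZ : ∀ j, Integrable (fun ω => Z ω j) μ) (i : m) :
    ∫ ω, (A *ᵥ Z ω) i ∂μ = (A *ᵥ fun j => ∫ ω, Z ω j ∂μ) i := by
  simp only [mulVec, dotProduct]
  rw [integral_finsetSum _ fun j _ => (hZ j).const_mul (A i j)]
  simp only [integral_const_mul]

/-- The expectation of a matrix acting on a linear model with centred noise. -/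
theorem integral_mulVec_add_centred {Ω m n : Type*} [Fintype n] [MeasurableSpace Ω]
    {μ : Measure Ω} [IsProbabilityMeasure μ] (A : Matrix m n ℝ) (v : n → ℝ) {ε : Ω → n → ℝ}
    (hint : ∀ j, Integrable (fun ω => ε ω j) μ) (hmean : ∀ j, ∫ ω, ε ω j ∂μ = 0) :
    (fun i => ∫ ω, (A *ᵥ (v + ε ω)) i ∂μ) = A *ᵥ v := by
  funext i
  rw [integral_mulVec_apply (Z := fun ω => v + ε ω) A fun j =>
    (integrable_const (v j)).add (hint j)]
  congr 2
  funext j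
  simp [integral_add (integrable_const (v j)) (hint j), hmean j]

/-- (Theorem 1, bias of the linear shrinkage estimator) For `w ∈ [0,1]`, the linear
shrinkage estimator `β̂ᴸˢ = w β̂ᴿ + (1−w) β̂ᴳ` has bias
`B(β̂ᴸˢ) = E[β̂ᴸˢ] − β = (S_K⁻¹S − I_p)β − w (I_p − M_K) S_K⁻¹ S β`. -/
theorem ls_bias (n p q : ℕ) (hn : 0 < n) (hq : 0 < q) (hqp : q < p)
    (X : Matrix (Fin n) (Fin p) ℝ)
    (K : Matrix (Fin p) (Fin p) ℝ) (hK : K.PosDef)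
    (SK : Matrix (Fin p) (Fin p) ℝ) (hSK : SK = Xᵀ * X + K)
    (H : Matrix (Fin q) (Fin p) ℝ) (hH : IsUnit (H * SK⁻¹ * Hᵀ))
    (MK : Matrix (Fin p) (Fin p) ℝ)
    (hMK : MK = 1 + SK⁻¹ * Hᵀ * (H * SK⁻¹ * Hᵀ)⁻¹ * H)
    (β : Fin p → ℝ)
    (w : ℝ) (hw0 : 0 ≤ w) (hw1 : w ≤ 1)
    (Ω : Type*) [MeasurableSpace Ω] (μ : Measure Ω) [IsProbabilityMeasure μ]
    (ε : Ω → Fin n → ℝ) (hεm : Measurable ε)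
    (hεint : ∀ i, Integrable (fun ω => ε ω i) μ)
    (hεmean : ∀ i, ∫ ω, ε ω i ∂μ = 0)
    (Y : Ω → Fin n → ℝ) (hY : ∀ ω, Y ω = X.mulVec β + ε ω)
    (βG : Ω → Fin p → ℝ) (hβG : ∀ ω, βG ω = (SK⁻¹ * Xᵀ).mulVec (Y ω))
    (βR : Ω → Fin p → ℝ) (hβR : ∀ ω, βR ω = MK.mulVec (βG ω))
    (βLS : Ω → Fin p → ℝ)
    (hβLS : ∀ ω, βLS ω = w • βR ω + (1 - w) • βG ω) :
    (fun i => ∫ ω, βLS ω i ∂μ) - β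
      = (SK⁻¹ * (Xᵀ * X) - 1).mulVec β
        - w • ((1 - MK).mulVec ((SK⁻¹ * (Xᵀ * X)).mulVec β)) := by
  have hlin : ∀ ω, βLS ω =
      ((w • MK + (1 - w) • (1 : Matrix (Fin p) (Fin p) ℝ)) * (SK⁻¹ * Xᵀ)) *ᵥ
        (X *ᵥ β + ε ω) := by
    intro ω
    rw [hβLS, hβR, hβG, hY, ← mulVec_mulVec _ (w • MK + _), add_mulVec, smul_mulVec, smul_mulVec, one_mulVec]
  simp only [hlin]
  rw [integral_mulVec_add_centred _ _ hεint hεmean, ← mulVec_mulVec, mulVec_mulVec β,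
    Matrix.mul_assoc, add_mulVec, smul_mulVec, smul_mulVec, one_mulVec, sub_mulVec,
    sub_mulVec, one_mulVec, one_mulVec]
  module
end
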